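/- Let X be a zero-dimensional Hausdorff space. The ring C(X, ℝ_disc) is self-injective if and only if X is extremally disconnected and a P_{𝔠⁺}-space (every intersection of at most 2^{ℵ₀} clopen sets is clopen). -/

import Mathlib

open Set Function

/-- A topological space is zero-dimensional if it has a basis of clopen sets. -/
def ZeroDimensional (X : Type*) [TopologicalSpace X] : Prop :=
  ∀ x : X, ∀ U : Set X, IsOpen U → x ∈ U → ∃ V : Set X, IsClopen V ∧ x ∈ V ∧ V ⊆ U

/-- Extension of functions that are locally constant on an open set. -/
theorem ext_of_inj {X : Type*} [TopologicalSpace X] (hzd : ZeroDimensional X)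
    (h : Module.Injective (LocallyConstant X ℝ) (LocallyConstant X ℝ))
    (U : Set X) (hU : IsOpen U) (g : X → ℝ)
    (hg : ∀ x ∈ U, ∀ᶠ y in nhds x, g y = g x) :
    ∃ r : LocallyConstant X ℝ, ∀ x ∈ U, r x = g x := by
  classical
  have hB := Module.Baer.of_injective h
  let I : Ideal (LocallyConstant X ℝ) :=
    { carrier := {a | ∀ x, x ∉ U → a x = 0}
      add_mem' := by
        intro a b ha hb x hx
        simp [ha x hx, hb x hx]
      zero_mem' := by intro x _; rfl
      smul_mem' := by
        intro c a ha x hx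
        simp [ha x hx] }
  have hlc : ∀ a : I, IsLocallyConstant (fun x => a.1 x * g x) := by
    intro a
    rw [IsLocallyConstant.iff_eventually_eq]
    intro x
    have h1 : ∀ᶠ y in nhds x, a.1 y = a.1 x :=
      (IsLocallyConstant.iff_eventually_eq _).1 a.1.isLocallyConstant x
    by_cases hx : x ∈ U
    · filter_upwards [h1, hg x hx] with y hy hy'
      rw [hy, hy']
    · have h0 : a.1 x = 0 := a.2 x hx
      filter_upwards [h1] with y hy
      rw [hy, h0]; simp
  let f : I →ₗ[LocallyConstant X ℝ] LocallyConstant X ℝ :=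
    { toFun := fun a => ⟨fun x => a.1 x * g x, hlc a⟩
      map_add' := by
        intro a b
        ext x
        simp [add_mul]
      map_smul' := by
        intro c a
        ext x
        simp [mul_assoc] }
  obtain ⟨φ, hφ⟩ := hB I f
  refine ⟨φ 1, fun x hx => ?_⟩
  obtain ⟨V, hV, hxV, hVU⟩ := hzd x U hU hx
  let e : LocallyConstant X ℝ := LocallyConstant.charFn ℝ hV
  have he1 : e x = 1 := by simp [e, LocallyConstant.coe_charFn, hxV]
  have heI : e ∈ I := by
    intro y hy
    have : y ∉ V := fun h => hy (hVU h)
    simp [e, LocallyConstant.coe_charFn, this]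
  have h2 := hφ e heI
  have h3 : φ e = e * φ 1 := by
    have := φ.map_smul e 1
    simpa using this
  have h4 := congrArg (fun q : LocallyConstant X ℝ => q x) (h3.symm.trans h2)
  have h5 : (f ⟨e, heI⟩) x = e x * g x := rfl
  simp only [h5, LocallyConstant.mul_apply, he1, one_mul] at h4
  exact h4

theorem disj_union {X : Type*} [TopologicalSpace X] (hzd : ZeroDimensional X)
    (h : Module.Injective (LocallyConstant X ℝ) (LocallyConstant X ℝ))
    (D : ℝ → Set X) (hD : ∀ t, IsClopen (D t))
    (hdis : ∀ s t x, x ∈ D s → x ∈ D t → s = t) : IsClopen (⋃ t, D t) := by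
  classical
  let g : X → ℝ := fun x => if hx : ∃ t, x ∈ D t then hx.choose else 0
  have hgD : ∀ t x, x ∈ D t → g x = t := by
    intro t x hx
    have hex : ∃ t, x ∈ D t := ⟨t, hx⟩
    have : g x = hex.choose := dif_pos hex
    rw [this]
    exact hdis _ _ x hex.choose_spec hx
  have hopen : IsOpen (⋃ t, D t) := isOpen_iUnion fun t => (hD t).isOpen
  obtain ⟨r, hr⟩ := ext_of_inj hzd h (⋃ t, D t) hopen g (by
    intro x hx
    obtain ⟨t, ht⟩ := mem_iUnion.1 hx
    filter_upwards [(hD t).isOpen.mem_nhds ht] with y hy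
    rw [hgD t y hy, hgD t x ht])
  refine ⟨?_, hopen⟩
  apply isClosed_of_closure_subset
  intro x hx
  rw [mem_iUnion]
  refine ⟨r x, ?_⟩
  rw [← (hD (r x)).isClosed.closure_eq]
  rw [mem_closure_iff_nhds] at hx ⊢
  intro W hW
  have h1 := (IsLocallyConstant.iff_eventually_eq _).1 r.isLocallyConstant x
  obtain ⟨y, ⟨hyW, hy⟩, hyU⟩ := hx _ (Filter.inter_mem hW h1)
  refine ⟨y, hyW, ?_⟩
  obtain ⟨t, ht⟩ := mem_iUnion.1 hyU
  have h2 := hr y hyU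
  rw [hgD t y ht] at h2
  have h3 : r y = r x := hy
  rw [← h3, h2]
  exact ht

theorem real_union {X : Type*} [TopologicalSpace X] (hzd : ZeroDimensional X)
    (h : Module.Injective (LocallyConstant X ℝ) (LocallyConstant X ℝ))
    (C : ℝ → Set X) (hC : ∀ t, IsClopen (C t)) : IsClopen (⋃ t, C t) := by
  classical
  let R : ℝ → ℝ → Prop := WellOrderingRel
  have hwf : WellFounded R := IsWellFounded.wf
  let E : ℝ → Set X := fun s => {x | ∃ t, R t s ∧ x ∈ C t}
  have hmin : ∀ x t, x ∈ C t → ∃ s, (s = t ∨ R s t) ∧ x ∈ C s \ E s := by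
    intro x t hx
    induction t using hwf.induction with
    | _ t ih =>
      by_cases hE : x ∈ E t
      · obtain ⟨s, hs, hxs⟩ := hE
        obtain ⟨u, hu, hxu⟩ := ih s hs hxs
        refine ⟨u, Or.inr ?_, hxu⟩
        rcases hu with rfl | hu
        · exact hs
        · exact _root_.trans hu hs
      · exact ⟨t, Or.inl rfl, hx, hE⟩
  have hdis : ∀ s t x, x ∈ C s \ E s → x ∈ C t \ E t → s = t := by
    intro s t x hs ht
    rcases trichotomous_of R s t with h1 | h1 | h1
    · exact absurd ⟨s, h1, hs.1⟩ ht.2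
    · exact h1
    · exact absurd ⟨t, h1, ht.1⟩ hs.2
  have hE : ∀ s, IsClopen (E s) := by
    intro s
    induction s using hwf.induction with
    | _ s ih =>
      have key : E s = ⋃ t, (if R t s then C t \ E t else ∅) := by
        ext x
        simp only [mem_iUnion]
        constructor
        · rintro ⟨t, hts, hx⟩
          obtain ⟨u, hu, hxu⟩ := hmin x t hx
          have hus : R u s := by
            rcases hu with rfl | hu
            · exact hts
            · exact _root_.trans hu hts
          exact ⟨u, by rw [if_pos hus]; exact hxu⟩
        · rintro ⟨t, hx⟩
          split_ifs at hx with hts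
          · exact ⟨t, hts, hx.1⟩
          · exact absurd hx (by simp)
      rw [key]
      apply disj_union hzd h
      · intro t
        split_ifs with hts
        · exact (hC t).diff (ih t hts)
        · exact isClopen_empty
      · intro a b x ha hb
        split_ifs at ha hb
        · exact hdis a b x ha hb
        all_goals simp at *
  have key : (⋃ t, C t) = ⋃ t, (C t \ E t) := by
    ext x
    simp only [mem_iUnion]
    constructor
    · rintro ⟨t, hx⟩
      obtain ⟨u, _, hu⟩ := hmin x t hx
      exact ⟨u, hu⟩
    · rintro ⟨t, hx⟩
      exact ⟨t, hx.1⟩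
  rw [key]
  exact disj_union hzd h _ (fun t => (hC t).diff (hE t)) hdis

theorem forward {X : Type*} [TopologicalSpace X] (hzd : ZeroDimensional X)
    (h : Module.Injective (LocallyConstant X ℝ) (LocallyConstant X ℝ)) :
    (ExtremallyDisconnected X ∧
        ∀ S : Set (Set X), (∀ A ∈ S, IsClopen A) → Cardinal.mk S ≤ Cardinal.continuum →
          IsClopen (⋂₀ S)) := by
  classical
  constructor
  · constructor
    intro U hU
    have hV : IsOpen (closure U)ᶜ := isClosed_closure.isOpen_compl
    let g : X → ℝ := fun x => if x ∈ U then 1 else 0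
    obtain ⟨r, hr⟩ := ext_of_inj hzd h (U ∪ (closure U)ᶜ) (hU.union hV) g (by
      rintro x (hx | hx)
      · filter_upwards [hU.mem_nhds hx] with y hy
        simp [g, hx, hy]
      · filter_upwards [hV.mem_nhds hx] with y hy
        have h1 : x ∉ U := fun h => hx (subset_closure h)
        have h2 : y ∉ U := fun h => hy (subset_closure h)
        simp [g, h1, h2])
    have hcl : IsClopen (r ⁻¹' {1}) := r.isLocallyConstant.isClopen_fiber 1
    have : closure U = r ⁻¹' {1} := by
      apply Subset.antisymm
      · apply closure_minimal _ hcl.isClosed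
        intro x hx
        have := hr x (Or.inl hx)
        simpa [g, hx] using this
      · intro x hx
        by_contra hxU
        have h1 : x ∉ U := fun h => hxU (subset_closure h)
        have := hr x (Or.inr hxU)
        have hx' : r x = 1 := hx
        simp [g, h1, hx'] at this
    rw [this]
    exact hcl.isOpen
  · intro S hS hc
    have hc' : Cardinal.lift.{0} (Cardinal.mk S) ≤ Cardinal.lift (Cardinal.mk ℝ) := by
      simpa [Cardinal.mk_real] using hc
    obtain ⟨i⟩ := Cardinal.lift_mk_le'.1 hc'
    have hcl := real_union hzd h (fun t => {x | ∃ s : S, i s = t ∧ x ∉ s.1}) (by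
      intro t
      by_cases ht : ∃ s, i s = t
      · obtain ⟨s, rfl⟩ := ht
        have : {x | ∃ s' : S, i s' = i s ∧ x ∉ s'.1} = s.1ᶜ := by
          ext x
          constructor
          · rintro ⟨s', h1, h2⟩
            rw [← i.injective h1]; exact h2
          · intro hx; exact ⟨s, rfl, hx⟩
        rw [this]
        exact (hS s.1 s.2).compl
      · have : {x | ∃ s' : S, i s' = t ∧ x ∉ s'.1} = ∅ := by
          ext x
          simp only [mem_setOf_eq, mem_empty_iff_false, iff_false]
          rintro ⟨s, h1, _⟩
          exact ht ⟨s, h1⟩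
        rw [this]
        exact isClopen_empty)
    have : ⋂₀ S = (⋃ t, {x | ∃ s : S, i s = t ∧ x ∉ s.1})ᶜ := by
      ext x
      simp only [mem_sInter, mem_compl_iff, mem_iUnion, mem_setOf_eq]
      constructor
      · rintro hx ⟨t, s, _, hs⟩
        exact hs (hx s.1 s.2)
      · intro hx A hA
        by_contra hxA
        exact hx ⟨_, ⟨A, hA⟩, rfl, hxA⟩
    rw [this]
    exact hcl.compl

theorem backward {X : Type*} [TopologicalSpace X]
    (hed : ExtremallyDisconnected X)
    (hP : ∀ S : Set (Set X), (∀ A ∈ S, IsClopen A) → Cardinal.mk S ≤ Cardinal.continuum →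
          IsClopen (⋂₀ S)) :
    Module.Injective (LocallyConstant X ℝ) (LocallyConstant X ℝ) := by
  classical
  apply Module.Baer.injective
  intro I f
  -- the local value relation
  let A : ℝ → Set X := fun t => {x | ∃ a : I, a.1 x = 1 ∧ f a x = t}
  have hev : ∀ (q : LocallyConstant X ℝ) x, ∀ᶠ y in nhds x, q y = q x := fun q =>
    (IsLocallyConstant.iff_eventually_eq _).1 q.isLocallyConstant
  have hcomm : ∀ a b : I, ∀ x, a.1 x * f b x = b.1 x * f a x := by
    intro a b x
    have h1 : a.1 • f b = b.1 • f a := by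
      rw [← map_smul, ← map_smul]
      congr 1
      ext1
      simp [mul_comm]
    exact congrArg (fun q : LocallyConstant X ℝ => q x) h1
  have hAo : ∀ t, IsOpen (A t) := by
    intro t
    rw [isOpen_iff_mem_nhds]
    rintro x ⟨a, h1, h2⟩
    filter_upwards [hev a.1 x, hev (f a) x] with y hy hy'
    exact ⟨a, hy.trans h1, hy'.trans h2⟩
  have hAd : ∀ s t, s ≠ t → Disjoint (A s) (A t) := by
    intro s t hst
    rw [Set.disjoint_left]
    rintro x ⟨a, h1, h2⟩ ⟨b, h3, h4⟩
    apply hst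
    have := hcomm a b x
    rw [h1, h2, h3, h4] at this
    linarith
  let B : ℝ → Set X := fun t => closure (A t)
  have hBc : ∀ t, IsClopen (B t) := fun t => ⟨isClosed_closure, hed.open_closure _ (hAo t)⟩
  have hBd : ∀ s t x, x ∈ B s → x ∈ B t → s = t := by
    intro s t x hs ht
    by_contra hst
    have h1 : Disjoint (B s) (A t) := (hAd s t hst).closure_left (hAo t)
    have h2 : Disjoint (B s) (B t) := h1.closure_right (hBc s).isOpen
    exact Set.disjoint_left.1 h2 hs ht
  have hC : IsClopen (⋂₀ (range fun t => (B t)ᶜ)) := by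
    apply hP
    · rintro _ ⟨t, rfl⟩
      exact (hBc t).compl
    · have := Cardinal.mk_range_le_lift (f := fun t => (B t)ᶜ)
      rw [Cardinal.mk_real] at this
      simpa using this
  let g : X → ℝ := fun x => if hx : ∃ t, x ∈ B t then hx.choose else 0
  have hgB : ∀ t x, x ∈ B t → g x = t := by
    intro t x hx
    have hex : ∃ t, x ∈ B t := ⟨t, hx⟩
    have : g x = hex.choose := dif_pos hex
    rw [this]
    exact hBd _ _ x hex.choose_spec hx
  have hg0 : ∀ x, x ∈ (⋂₀ (range fun t => (B t)ᶜ)) → g x = 0 := by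
    intro x hx
    apply dif_neg
    rintro ⟨t, ht⟩
    exact hx _ ⟨t, rfl⟩ ht
  have hglc : IsLocallyConstant g := by
    rw [IsLocallyConstant.iff_eventually_eq]
    intro x
    by_cases hx : ∃ t, x ∈ B t
    · obtain ⟨t, ht⟩ := hx
      filter_upwards [(hBc t).isOpen.mem_nhds ht] with y hy
      rw [hgB t y hy, hgB t x ht]
    · have hx' : x ∈ (⋂₀ (range fun t => (B t)ᶜ)) := by
        rintro _ ⟨t, rfl⟩ ht
        exact hx ⟨t, ht⟩
      filter_upwards [hC.isOpen.mem_nhds hx'] with y hy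
      rw [hg0 y hy, hg0 x hx']
  let r : LocallyConstant X ℝ := ⟨g, hglc⟩
  refine ⟨LinearMap.toSpanSingleton _ _ r, ?_⟩
  intro a ha
  ext x
  have goal' : a x * g x = f ⟨a, ha⟩ x := by
    -- the quasi-inverse of `a`
    let b : LocallyConstant X ℝ := a.map (fun y => y⁻¹)
    let e : I := ⟨b * a, I.mul_mem_left b ha⟩
    have hx0 : e.1 x = (a x)⁻¹ * a x := rfl
    by_cases h0 : a x = 0
    · -- a = (a * b) * a
      have h1 : (⟨a, ha⟩ : I) = a • e := by
        ext1
        ext y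
        change a y = a y * ((a y)⁻¹ * a y)
        by_cases hy : a y = 0
        · simp [hy]
        · field_simp
      rw [h1, map_smul]
      change a x * g x = a x * f e x
      simp [h0]
    · have h1 : e.1 x = 1 := by rw [hx0]; exact inv_mul_cancel₀ h0
      have h2 : g x = f e x := hgB _ x (subset_closure ⟨e, h1, rfl⟩)
      have h3 := hcomm ⟨a, ha⟩ e x
      rw [h1, one_mul] at h3
      rw [h2]; exact h3
  exact goal'

/-- For a zero-dimensional Hausdorff space `X`, the ring `C(X, ℝ_disc)` of continuous locally
constant real functions is self-injective if and only if `X` is extremally disconnected and a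
`P_{𝔠⁺}`-space (every intersection of at most `2^ℵ₀` clopen sets is clopen). -/
theorem stmt14 (X : Type*) [TopologicalSpace X] [T2Space X] (hzd : ZeroDimensional X) :
    Module.Injective (LocallyConstant X ℝ) (LocallyConstant X ℝ) ↔
      (ExtremallyDisconnected X ∧
        ∀ S : Set (Set X), (∀ A ∈ S, IsClopen A) → Cardinal.mk S ≤ Cardinal.continuum →
          IsClopen (⋂₀ S)) :=
  ⟨forward hzd, fun h => backward h.1 h.2⟩
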